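/- There exist a degree bound d ∈ ℕ, a Hamming bound Δ ∈ ℕ, and constants c, C > 0 such that for every sufficiently large n there is a digraph H on vertex set {0,1}^n with a distinguished vertex v₀, in which every vertex has in-degree at most d and out-degree at most d, and in which the labels of any two adjacent vertices differ in at most Δ coordinates, such that the critical block sensitivity of QEoL_H is at least c·2^n/n^C; i.e., for every function f mapping each x ∈ {0,1}^{E(H)} to a solution of x, there exists a critical input x* (an input with exactly one solution) and at least c·2^n/n^C pairwise disjoint sets B₁,…,B_b ⊆ E(H) such that f(x*^{B_i}) ≠ f(x*) for each i, where x*^{B} denotes x* with all bits in B flipped. -/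

import Mathlib

/-!
STATEMENT 2: A bounded-degree host digraph `H` on `{0,1}^n` whose adjacent
vertices have labels differing in at most `Δ` coordinates, for which the
critical block sensitivity of `QEoL_H` is at least `c·2^n/n^C`.
-/

/-- Vertices: boolean strings of length `n`. -/
abbrev BStr (n : ℕ) := Fin n → Bool

/-- In-degree of `v` in the spanning subgraph `G_x` of the host graph with edge
set `EH`, where `x : {e // e ∈ EH} → Bool` selects the edges. -/
def qIndeg {n : ℕ} (EH : Finset (BStr n × BStr n)) (x : {e // e ∈ EH} → Bool)
    (v : BStr n) : ℕ :=
  (Finset.univ.filter (fun e : {e // e ∈ EH} => e.1.2 = v ∧ x e = true)).card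

/-- Out-degree of `v` in the spanning subgraph `G_x`. -/
def qOutdeg {n : ℕ} (EH : Finset (BStr n × BStr n)) (x : {e // e ∈ EH} → Bool)
    (v : BStr n) : ℕ :=
  (Finset.univ.filter (fun e : {e // e ∈ EH} => e.1.1 = v ∧ x e = true)).card

/-- `v` is a solution of the input `x` to `QEoL_H` with distinguished vertex `v₀`. -/
def QSolution {n : ℕ} (EH : Finset (BStr n × BStr n)) (v₀ : BStr n)
    (x : {e // e ∈ EH} → Bool) (v : BStr n) : Prop :=
  (v = v₀ ∧ ¬ (qIndeg EH x v = 0 ∧ qOutdeg EH x v = 1)) ∨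
  (v ≠ v₀ ∧ 1 ≤ qIndeg EH x v + qOutdeg EH x v ∧
    ¬ (qIndeg EH x v = 1 ∧ qOutdeg EH x v = 1))

/-- An input is critical if it has exactly one solution. -/
def QCritical {n : ℕ} (EH : Finset (BStr n × BStr n)) (v₀ : BStr n)
    (x : {e // e ∈ EH} → Bool) : Prop :=
  ∃! v, QSolution EH v₀ x v

/-- `x` with all bits in `B` flipped. -/
def flipBits {n : ℕ} (EH : Finset (BStr n × BStr n)) (x : {e // e ∈ EH} → Bool)
    (B : Finset {e // e ∈ EH}) : {e // e ∈ EH} → Bool :=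
  fun e => if e ∈ B then !(x e) else x e


/-! ### Inputs given by an edge relation -/

open Classical in
/-- The input selecting the edges of the host that satisfy the relation `S`. -/
noncomputable def relInput {n : ℕ} (EH : Finset (BStr n × BStr n))
    (S : BStr n → BStr n → Prop) : {e // e ∈ EH} → Bool :=
  fun e => decide (S e.1.1 e.1.2)

open Classical in
theorem qOutdeg_relInput {n : ℕ} {EH : Finset (BStr n × BStr n)}
    {S : BStr n → BStr n → Prop} (hS : ∀ u v, S u v → (u, v) ∈ EH)
    (hfun : ∀ u v w, S u v → S u w → v = w) (v : BStr n) :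
    qOutdeg EH (relInput EH S) v = if ∃ w, S v w then 1 else 0 := by
  unfold qOutdeg relInput
  split_ifs with h
  · obtain ⟨w, hw⟩ := h
    rw [Finset.card_eq_one]
    refine ⟨⟨(v, w), hS _ _ hw⟩, ?_⟩
    ext ⟨⟨a, b⟩, hab⟩
    simp only [Finset.mem_filter, Finset.mem_univ, true_and, decide_eq_true_eq,
      Finset.mem_singleton, Subtype.mk.injEq, Prod.mk.injEq]
    constructor
    · rintro ⟨rfl, h⟩
      exact ⟨rfl, hfun _ _ _ h hw⟩
    · rintro ⟨rfl, rfl⟩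
      exact ⟨rfl, hw⟩
  · rw [Finset.card_eq_zero, Finset.filter_eq_empty_iff]
    rintro ⟨⟨a, b⟩, hab⟩ -
    simp only [decide_eq_true_eq, not_and]
    rintro rfl h'
    exact h ⟨_, h'⟩

open Classical in
theorem qIndeg_relInput {n : ℕ} {EH : Finset (BStr n × BStr n)}
    {S : BStr n → BStr n → Prop} (hS : ∀ u v, S u v → (u, v) ∈ EH)
    (hinj : ∀ u v w, S u w → S v w → u = v) (v : BStr n) :
    qIndeg EH (relInput EH S) v = if ∃ u, S u v then 1 else 0 := by
  unfold qIndeg relInput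
  split_ifs with h
  · obtain ⟨w, hw⟩ := h
    rw [Finset.card_eq_one]
    refine ⟨⟨(w, v), hS _ _ hw⟩, ?_⟩
    ext ⟨⟨a, b⟩, hab⟩
    simp only [Finset.mem_filter, Finset.mem_univ, true_and, decide_eq_true_eq,
      Finset.mem_singleton, Subtype.mk.injEq, Prod.mk.injEq]
    constructor
    · rintro ⟨rfl, h⟩
      exact ⟨hinj _ _ _ h hw, rfl⟩
    · rintro ⟨rfl, rfl⟩
      exact ⟨rfl, hw⟩
  · rw [Finset.card_eq_zero, Finset.filter_eq_empty_iff]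
    rintro ⟨⟨a, b⟩, hab⟩ -
    simp only [decide_eq_true_eq, not_and]
    rintro rfl h'
    exact h ⟨_, h'⟩

theorem qSolution_relInput_iff {n : ℕ} {EH : Finset (BStr n × BStr n)}
    {S : BStr n → BStr n → Prop} {v₀ T : BStr n} (hS : ∀ u v, S u v → (u, v) ∈ EH)
    (hfun : ∀ u v w, S u v → S u w → v = w) (hinj : ∀ u v w, S u w → S v w → u = v)
    (hin : ∀ v, (∃ u, S u v) ↔ ((∃ w, S v w) ∨ v = T) ∧ v ≠ v₀)
    (hT : ¬ ∃ w, S T w) (h₀ : v₀ ≠ T → ∃ w, S v₀ w) (v : BStr n) :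
    QSolution EH v₀ (relInput EH S) v ↔ v = T := by
  unfold QSolution
  rw [qIndeg_relInput hS hinj, qOutdeg_relInput hS hfun]
  have h := hin v
  by_cases hv : v = v₀
  · subst hv
    by_cases hvT : v = T
    · subst hvT
      simp [hT]
    · simp_all
  · by_cases hvT : v = T
    · subst hvT
      simp_all
    · simp only [hv, hvT, or_false, ne_eq, not_false_eq_true, and_true] at h
      by_cases ho : ∃ w, S v w <;> simp [hv, hvT, h, ho]

/-! ### Systems of paths -/

/-- The edges of the paths `q a` (of length `N a`) for the indices `a` outside `D`, together with
an edge from the terminal `en b` to the terminal `st b` for every `b ≠ z`. -/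
def PathEdges {A V : Type*} (st en : A → V) (z : A) (q : A → ℕ → V) (N : A → ℕ) (D : A → Prop)
    (u v : V) : Prop :=
  (∃ a i, ¬ D a ∧ i < N a ∧ u = q a i ∧ v = q a (i + 1)) ∨ ∃ b, b ≠ z ∧ u = en b ∧ v = st b

/-- A system of vertex-disjoint paths, the path `q a` leading from `st a` to `en (π a)`, for all
indices `a` other than `π⁻¹ z`. -/
structure IsPathSystem {A V : Type*} (st en : A → V) (z : A) (π : Equiv.Perm A) (q : A → ℕ → V)
    (N : A → ℕ) : Prop where
  start : ∀ a, q a 0 = st a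
  finish : ∀ a, q a (N a) = en (π a)
  inj : ∀ a a' i i', π a ≠ z → π a' ≠ z → i ≤ N a → i' ≤ N a' → q a i = q a' i' → a = a' ∧ i = i'
  avoid : ∀ a i t, π t = z → π a ≠ z → i ≤ N a → q a i ≠ st t

namespace IsPathSystem

variable {A V : Type*} {st en : A → V} {z : A} {π : Equiv.Perm A} {q : A → ℕ → V} {N : A → ℕ}

theorem st_injective (h : IsPathSystem st en z π q N) : Function.Injective st := by
  intro a b hab
  by_cases ha : π a = z
  · by_cases hb : π b = z
    · exact π.injective (ha.trans hb.symm)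
    · exact absurd ((h.start b).trans hab.symm) (h.avoid b 0 a ha hb (Nat.zero_le _))
  · by_cases hb : π b = z
    · exact absurd ((h.start a).trans hab) (h.avoid a 0 b hb ha (Nat.zero_le _))
    · exact (h.inj a b 0 0 ha hb (Nat.zero_le _) (Nat.zero_le _)
        (by rw [h.start, h.start, hab])).1

theorem edge_cases (h : IsPathSystem st en z π q N) {u v : V}
    (hS : PathEdges st en z q N (fun a => π a = z) u v) :
    ∃ a i, π a ≠ z ∧ i ≤ N a ∧ u = q a i ∧
      ((i < N a ∧ v = q a (i + 1)) ∨ (i = N a ∧ v = st (π a))) := by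
  rcases hS with ⟨a, i, ha, hi, rfl, rfl⟩ | ⟨b, hb, rfl, rfl⟩
  · exact ⟨a, i, ha, hi.le, rfl, Or.inl ⟨hi, rfl⟩⟩
  · refine ⟨π.symm b, N (π.symm b), by simpa using hb, le_rfl, ?_, Or.inr ⟨rfl, by simp⟩⟩
    rw [h.finish]
    simp

theorem out_iff (h : IsPathSystem st en z π q N) (u : V) :
    (∃ v, PathEdges st en z q N (fun a => π a = z) u v) ↔ ∃ a i, π a ≠ z ∧ i ≤ N a ∧ u = q a i := by
  constructor
  · rintro ⟨v, hv⟩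
    obtain ⟨a, i, ha, hi, hu, -⟩ := h.edge_cases hv
    exact ⟨a, i, ha, hi, hu⟩
  · rintro ⟨a, i, ha, hi, rfl⟩
    rcases hi.lt_or_eq with hi | rfl
    · exact ⟨_, Or.inl ⟨a, i, ha, hi, rfl, rfl⟩⟩
    · exact ⟨_, Or.inr ⟨π a, ha, h.finish a, rfl⟩⟩

theorem edge_right_unique (h : IsPathSystem st en z π q N) (u v w : V)
    (h₁ : PathEdges st en z q N (fun a => π a = z) u v)
    (h₂ : PathEdges st en z q N (fun a => π a = z) u w) : v = w := by
  obtain ⟨a, i, ha, hi, rfl, hv⟩ := h.edge_cases h₁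
  obtain ⟨a', i', ha', hi', he, hw⟩ := h.edge_cases h₂
  obtain ⟨rfl, rfl⟩ := h.inj _ _ _ _ ha ha' hi hi' he
  rcases hv with ⟨hv, rfl⟩ | ⟨hv, rfl⟩ <;> rcases hw with ⟨hw, rfl⟩ | ⟨hw, rfl⟩
  · rfl
  · omega
  · omega
  · rfl

theorem succ_ne_st (h : IsPathSystem st en z π q N) {a b : A} {i : ℕ} (ha : π a ≠ z)
    (hi : i < N a) : q a (i + 1) ≠ st b := by
  intro he
  by_cases hb : π b = z
  · exact h.avoid a (i + 1) b hb ha hi he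
  · rw [← h.start b] at he
    have := (h.inj _ _ _ _ ha hb hi (Nat.zero_le _) he).2
    omega

theorem edge_left_unique (h : IsPathSystem st en z π q N) (u v w : V)
    (h₁ : PathEdges st en z q N (fun a => π a = z) u w)
    (h₂ : PathEdges st en z q N (fun a => π a = z) v w) : u = v := by
  obtain ⟨a, i, ha, hi, rfl, hv⟩ := h.edge_cases h₁
  obtain ⟨a', i', ha', hi', rfl, hw⟩ := h.edge_cases h₂
  rcases hv with ⟨hv, rfl⟩ | ⟨rfl, rfl⟩ <;> rcases hw with ⟨hw, he⟩ | ⟨rfl, he⟩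
  · obtain ⟨rfl, h'⟩ := h.inj _ _ _ _ ha ha' hv hw he
    obtain rfl : i = i' := by omega
    rfl
  · exact absurd he (h.succ_ne_st ha hv)
  · exact absurd he.symm (h.succ_ne_st ha' hw)
  · obtain rfl := π.injective (h.st_injective he)
    rfl

theorem in_iff (h : IsPathSystem st en z π q N) {t : A} (ht : π t = z) (v : V) :
    (∃ u, PathEdges st en z q N (fun a => π a = z) u v) ↔
      ((∃ w, PathEdges st en z q N (fun a => π a = z) v w) ∨ v = st t) ∧ v ≠ st z := by
  rw [h.out_iff]
  constructor
  · rintro ⟨u, ⟨a, i, ha, hi, rfl, rfl⟩ | ⟨b, hb, rfl, rfl⟩⟩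
    · exact ⟨Or.inl ⟨a, i + 1, ha, hi, rfl⟩, h.succ_ne_st ha hi⟩
    · refine ⟨?_, fun he => hb (h.st_injective he)⟩
      by_cases hbt : π b = z
      · obtain rfl := π.injective (hbt.trans ht.symm)
        exact Or.inr rfl
      · exact Or.inl ⟨b, 0, hbt, Nat.zero_le _, (h.start b).symm⟩
  · rintro ⟨⟨a, i, ha, hi, rfl⟩ | rfl, hz⟩
    · rcases i with _ | i
      · rw [h.start] at hz ⊢
        exact ⟨_, Or.inr ⟨a, fun he => hz (by rw [he]), rfl, rfl⟩⟩
      · exact ⟨_, Or.inl ⟨a, i, ha, hi, rfl, rfl⟩⟩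
    · exact ⟨_, Or.inr ⟨t, fun he => hz (by rw [he]), rfl, rfl⟩⟩

theorem qSolution_iff {n : ℕ} {EH : Finset (BStr n × BStr n)} {st en : A → BStr n}
    {q : A → ℕ → BStr n} (h : IsPathSystem st en z π q N) {t : A} (ht : π t = z)
    (hS : ∀ u v, PathEdges st en z q N (fun a => π a = z) u v → (u, v) ∈ EH) (v : BStr n) :
    QSolution EH (st z) (relInput EH (PathEdges st en z q N fun a => π a = z)) v ↔ v = st t := by
  refine qSolution_relInput_iff hS h.edge_right_unique h.edge_left_unique (h.in_iff ht) ?_ ?_ v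
  · rw [h.out_iff]
    rintro ⟨a, i, ha, hi, he⟩
    exact h.avoid a i t ht ha hi he.symm
  · intro hz
    rw [h.out_iff]
    refine ⟨z, 0, fun hzz => hz ?_, Nat.zero_le _, (h.start z).symm⟩
    rw [π.injective (ht.trans hzz.symm)]

/-- The edges of the path `q a`, as a block of input bits. -/
noncomputable def _root_.pathBlock {n : ℕ} (EH : Finset (BStr n × BStr n)) (q : A → ℕ → BStr n)
    (N : A → ℕ) (a : A) : Finset {e // e ∈ EH} :=
  open Classical in
  Finset.univ.filter fun e => ∃ i, i < N a ∧ e.1.1 = q a i ∧ e.1.2 = q a (i + 1)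

theorem disjoint_pathBlock {n : ℕ} {EH : Finset (BStr n × BStr n)} {st en : A → BStr n}
    {q : A → ℕ → BStr n} (h : IsPathSystem st en z π q N) {a b : A} (ha : π a ≠ z) (hb : π b ≠ z)
    (hab : a ≠ b) : Disjoint (pathBlock EH q N a) (pathBlock EH q N b) := by
  rw [Finset.disjoint_left]
  intro e he he'
  simp only [pathBlock, Finset.mem_filter, Finset.mem_univ, true_and] at he he'
  obtain ⟨i, hi, hi', -⟩ := he
  obtain ⟨j, hj, hj', -⟩ := he'
  exact hab (h.inj _ _ _ _ ha hb hi.le hj.le (hi'.symm.trans hj')).1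

theorem flipBits_pathBlock {n : ℕ} {EH : Finset (BStr n × BStr n)} {st en : A → BStr n}
    {q : A → ℕ → BStr n} (h : IsPathSystem st en z π q N) {a : A} (ha : π a ≠ z) :
    flipBits EH (relInput EH (PathEdges st en z q N fun a => π a = z)) (pathBlock EH q N a) =
      relInput EH (PathEdges st en z q N fun b => π b = z ∨ b = a) := by
  funext e
  obtain ⟨⟨u, v⟩, huv⟩ := e
  simp only [flipBits, pathBlock, relInput, Finset.mem_filter, Finset.mem_univ, true_and]
  split_ifs with hB
  · obtain ⟨i, hi, rfl, rfl⟩ := hB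
    have h₁ : PathEdges st en z q N (fun a => π a = z) (q a i) (q a (i + 1)) :=
      Or.inl ⟨a, i, ha, hi, rfl, rfl⟩
    have h₂ : ¬ PathEdges st en z q N (fun b => π b = z ∨ b = a) (q a i) (q a (i + 1)) := by
      rintro (⟨b, j, hb, hj, he, -⟩ | ⟨b, hb, he, -⟩)
      · push Not at hb
        exact hb.2 (h.inj _ _ _ _ ha hb.1 hi.le hj.le he).1.symm
      · have hf := h.finish (π.symm b)
        rw [Equiv.apply_symm_apply] at hf
        rw [← hf] at he
        obtain ⟨rfl, h'⟩ := h.inj _ _ _ _ ha (by simpa using hb) hi.le le_rfl he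
        omega
    simp [h₁, h₂]
  · congr 1
    refine propext (or_congr_left ⟨?_, ?_⟩)
    · rintro ⟨b, j, hb, hj, rfl, rfl⟩
      refine ⟨b, j, ?_, hj, rfl, rfl⟩
      rintro (hb' | rfl)
      · exact hb hb'
      · exact hB ⟨j, hj, rfl, rfl⟩
    · rintro ⟨b, j, hb, hj, rfl, rfl⟩
      exact ⟨b, j, fun hb' => hb (Or.inl hb'), hj, rfl, rfl⟩

end IsPathSystem

/-! ### A strictly nonblocking network -/

/-- The string that agrees with `c` on the first `s` positions and with `a` on the others. -/
def mix {m : ℕ} (s : ℕ) (c a : BStr m) : BStr m := fun i => if i.val < s then c i else a i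

/-- `w` with the bit at position `s` replaced by `b`. -/
def setBit {m : ℕ} (s : ℕ) (b : Bool) (w : BStr m) : BStr m := fun i => if i.val = s then b else w i

theorem mix_zero {m : ℕ} (c a : BStr m) : mix 0 c a = a := by
  funext i
  simp [mix]

theorem mix_top {m : ℕ} (c a : BStr m) : mix m c a = c := by
  funext i
  simp [mix]

theorem exists_mix_succ_eq_setBit {m : ℕ} (s : ℕ) (c a : BStr m) :
    ∃ b, mix (s + 1) c a = setBit s b (mix s c a) := by
  by_cases hs : s < m
  · refine ⟨c ⟨s, hs⟩, ?_⟩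
    funext i
    rcases lt_trichotomy i.val s with h | h | h
    · simp [mix, setBit, h, h.ne, Nat.lt_succ_of_lt h]
    · subst h
      simp [mix, setBit]
    · simp [mix, setBit, h.ne', not_lt.2 h.le, not_lt.2 (Nat.succ_le_of_lt h)]
  · refine ⟨true, ?_⟩
    funext i
    have := i.isLt
    have h₁ : i.val < s := by omega
    simp [mix, setBit, h₁, h₁.ne, Nat.lt_succ_of_lt h₁]

theorem exists_mix_eq_setBit_succ {m : ℕ} (s : ℕ) (c a : BStr m) :
    ∃ b, mix s c a = setBit s b (mix (s + 1) c a) := by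
  by_cases hs : s < m
  · refine ⟨a ⟨s, hs⟩, ?_⟩
    funext i
    rcases lt_trichotomy i.val s with h | h | h
    · simp [mix, setBit, h, h.ne, Nat.lt_succ_of_lt h]
    · subst h
      simp [mix, setBit]
    · simp [mix, setBit, h.ne', not_lt.2 h.le, not_lt.2 (Nat.succ_le_of_lt h)]
  · refine ⟨true, ?_⟩
    funext i
    have := i.isLt
    have h₁ : i.val < s := by omega
    simp [mix, setBit, h₁, h₁.ne, Nat.lt_succ_of_lt h₁]

/-- Network vertices: side of the network, number of the butterfly, stage, and row. -/
abbrev NetVertex (m : ℕ) := Bool × ℕ × ℕ × BStr m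

/-- A set containing all in- and out-neighbours of a network vertex. -/
def neighbours {m : ℕ} (u : NetVertex m) : Finset (NetVertex m) :=
  {(u.1, u.2.1 + 1, u.2.2.1, u.2.2.2), (u.1, u.2.1 - 1, u.2.2.1, u.2.2.2),
    (u.1, u.2.1, u.2.2.1 + 1, setBit u.2.2.1 true u.2.2.2),
    (u.1, u.2.1, u.2.2.1 + 1, setBit u.2.2.1 false u.2.2.2),
    (u.1, u.2.1, u.2.2.1 - 1, setBit (u.2.2.1 - 1) true u.2.2.2),
    (u.1, u.2.1, u.2.2.1 - 1, setBit (u.2.2.1 - 1) false u.2.2.2),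
    (!u.1, u.2.1, u.2.2.1, u.2.2.2)}

theorem card_neighbours_le {m : ℕ} (u : NetVertex m) : (neighbours u).card ≤ 7 := by
  unfold neighbours
  iterate 6 refine (Finset.card_insert_le _ _).trans (Nat.succ_le_succ ?_)
  simp

/-- The route of row `a` in one side of the network: along row `a` to the butterfly `l.1`, and
then through this butterfly to row `l.2`. -/
def halfRoute {m K : ℕ} (a : BStr m) (l : Fin K × BStr m) (i : ℕ) : ℕ × ℕ × BStr m :=
  (min i l.1, i - l.1, mix (i - l.1) l.2 a)

/-- The route from row `a` to row `b` through the row `l.2` in the middle of the butterfly `l.1`. -/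
def route {m K : ℕ} (a b : BStr m) (l : Fin K × BStr m) (i : ℕ) : NetVertex m :=
  if i ≤ l.1 + m then (false, halfRoute a l i) else (true, halfRoute b l (2 * (l.1 + m) + 1 - i))

/-- The number of edges of a route with label `l`. -/
def routeLength {m K : ℕ} (l : Fin K × BStr m) : ℕ := 2 * (l.1 + m) + 1

theorem halfRoute_zero {m K : ℕ} (a : BStr m) (l : Fin K × BStr m) :
    halfRoute a l 0 = (0, 0, a) := by
  simp [halfRoute, mix_zero]

theorem route_zero {m K : ℕ} (a b : BStr m) (l : Fin K × BStr m) :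
    route a b l 0 = (false, 0, 0, a) := by
  simp [route, halfRoute_zero]

theorem route_length {m K : ℕ} (a b : BStr m) (l : Fin K × BStr m) :
    route a b l (routeLength l) = (true, 0, 0, b) := by
  have : ¬ 2 * ((l.1 : ℕ) + m) + 1 ≤ l.1 + m := by omega
  simp [route, routeLength, halfRoute_zero, this]

theorem route_valid {m K : ℕ} (a b : BStr m) (l : Fin K × BStr m) (i : ℕ) :
    (route a b l i).2.1 < K ∧ (route a b l i).2.2.1 ≤ m := by
  have := l.1.isLt
  unfold route halfRoute
  split_ifs <;> dsimp only <;> omega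

theorem mem_neighbours_halfRoute {m K : ℕ} (x : Bool) (a : BStr m) (l : Fin K × BStr m) (i : ℕ) :
    (x, halfRoute a l (i + 1)) ∈ neighbours (x, halfRoute a l i) ∧
      (x, halfRoute a l i) ∈ neighbours (x, halfRoute a l (i + 1)) := by
  unfold halfRoute
  rcases lt_or_ge i l.1 with h | h
  · have h₁ : min i (l.1 : ℕ) = i := by omega
    have h₂ : min (i + 1) (l.1 : ℕ) = i + 1 := by omega
    have h₃ : i - (l.1 : ℕ) = 0 := by omega
    have h₄ : i + 1 - (l.1 : ℕ) = 0 := by omega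
    simp [h₁, h₂, h₃, h₄, neighbours]
  · have h₁ : min i (l.1 : ℕ) = l.1 := by omega
    have h₂ : min (i + 1) (l.1 : ℕ) = l.1 := by omega
    have h₃ : i + 1 - (l.1 : ℕ) = i - l.1 + 1 := by omega
    rw [h₁, h₂, h₃]
    constructor
    · obtain ⟨b, hb⟩ := exists_mix_succ_eq_setBit (i - l.1) l.2 a
      rw [hb]
      cases b <;> simp [neighbours]
    · obtain ⟨b, hb⟩ := exists_mix_eq_setBit_succ (i - l.1) l.2 a
      rw [hb]
      cases b <;> simp [neighbours]

theorem mem_neighbours_not {m : ℕ} (x : Bool) (v : ℕ × ℕ × BStr m) :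
    (!x, v) ∈ neighbours (x, v) ∧ (x, v) ∈ neighbours (!x, v) := by
  simp [neighbours]

theorem mem_neighbours_route {m K : ℕ} (a b : BStr m) (l : Fin K × BStr m) {i : ℕ}
    (hi : i < routeLength l) :
    route a b l (i + 1) ∈ neighbours (route a b l i) ∧
      route a b l i ∈ neighbours (route a b l (i + 1)) := by
  unfold routeLength at hi
  unfold route
  rcases lt_trichotomy i (l.1 + m) with h | h | h
  · rw [if_pos (Nat.succ_le_of_lt h), if_pos h.le]
    exact mem_neighbours_halfRoute _ _ _ _
  · have h₁ : ¬ i + 1 ≤ l.1 + m := by omega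
    rw [if_neg h₁, if_pos h.le]
    have h₂ : 2 * ((l.1 : ℕ) + m) + 1 - (i + 1) = l.1 + m := by omega
    have h₃ : ∀ a : BStr m, halfRoute a l (l.1 + m) = (l.1.val, m, l.2) := fun a => by
      simp [halfRoute, mix_top]
    rw [h₂, h, h₃, h₃]
    exact mem_neighbours_not false _
  · have h₁ : ¬ i + 1 ≤ l.1 + m := by omega
    rw [if_neg h₁, if_neg (by omega)]
    have h₂ : 2 * ((l.1 : ℕ) + m) + 1 - i = 2 * (l.1 + m) + 1 - (i + 1) + 1 := by omega
    rw [h₂]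
    exact (mem_neighbours_halfRoute _ _ _ _).symm

/-- The half routes of `a` with label `l` and of `a'` with label `l'` meet in a butterfly. -/
def HalfConflict {m K : ℕ} (a : BStr m) (l : Fin K × BStr m) (a' : BStr m) (l' : Fin K × BStr m) :
    Prop :=
  l.1 = l'.1 ∧ ∃ s ≤ m, mix s l.2 a = mix s l'.2 a'

theorem HalfConflict.symm {m K : ℕ} {a a' : BStr m} {l l' : Fin K × BStr m}
    (h : HalfConflict a l a' l') : HalfConflict a' l' a l :=
  ⟨h.1.symm, h.2.imp fun _ hs => ⟨hs.1, hs.2.symm⟩⟩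

theorem halfConflict_of_halfRoute_eq {m K : ℕ} {a a' : BStr m} {l l' : Fin K × BStr m} {i i' : ℕ}
    (hi : i ≤ l.1 + m) (h : halfRoute a l i = halfRoute a' l' i') :
    i = i' ∧ (a ≠ a' → HalfConflict a l a' l') := by
  simp only [halfRoute, Prod.mk.injEq] at h
  obtain ⟨h₁, h₂, h₃⟩ := h
  refine ⟨by omega, fun ha => ?_⟩
  rw [← h₂] at h₃
  rcases Nat.eq_zero_or_pos (i - l.1) with h₀ | h₀
  · rw [h₀, mix_zero, mix_zero] at h₃
    exact absurd h₃ ha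
  · exact ⟨Fin.ext (by omega), i - l.1, by omega, h₃⟩

theorem route_inj {m K : ℕ} {a a' b b' : BStr m} {l l' : Fin K × BStr m} {i i' : ℕ}
    (hi : i ≤ routeLength l) (hi' : i' ≤ routeLength l')
    (h : route a b l i = route a' b' l' i') :
    (a ≠ a' → b ≠ b' → HalfConflict a l a' l' ∨ HalfConflict b l b' l') ∧ (l = l' → i = i') := by
  unfold routeLength at hi hi'
  unfold route at h
  split_ifs at h with h₁ h₂ h₂
  · have := halfConflict_of_halfRoute_eq h₁ (Prod.mk.inj h).2
    exact ⟨fun ha _ => Or.inl (this.2 ha), fun _ => this.1⟩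
  · simp at h
  · simp at h
  · have := halfConflict_of_halfRoute_eq (by omega) (Prod.mk.inj h).2
    refine ⟨fun _ hb => Or.inr (this.2 hb), ?_⟩
    rintro rfl
    omega

theorem route_ne_start {m K : ℕ} {a b t : BStr m} (l : Fin K × BStr m) (i : ℕ)
    (ha : a ≠ t) : route a b l i ≠ (false, 0, 0, t) := by
  unfold route halfRoute
  split_ifs with h
  · intro he
    simp only [Prod.mk.injEq, true_and] at he
    obtain ⟨-, h₁, h₂⟩ := he
    rw [h₁, mix_zero] at h₂
    exact ha h₂
  · simp

open Classical in
theorem card_halfConflict_le {m K : ℕ} (a : BStr m) (μ : BStr m → Fin K × BStr m) :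
    (Finset.univ.filter fun l => ∃ a', HalfConflict a l a' (μ a')).card ≤ (m + 1) * 2 ^ m := by
  let G : Fin (m + 1) × BStr m → Fin K × BStr m := fun p =>
    ((μ (mix p.1 p.2 a)).1, mix p.1 (μ (mix p.1 p.2 a)).2 p.2)
  calc _ ≤ (Finset.univ.image G).card := by
        refine Finset.card_le_card fun l hl => ?_
        simp only [Finset.mem_filter, Finset.mem_univ, true_and] at hl
        obtain ⟨a', h₁, s, hs, h₂⟩ := hl
        simp only [Finset.mem_image, Finset.mem_univ, true_and]
        have key : ∀ i : Fin m, (if i.val < s then l.2 i = (μ a').2 i else a i = a' i) := by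
          intro i
          have := congrFun h₂ i
          simp only [mix] at this
          split_ifs at this ⊢ <;> exact this
        have ha' : mix s (mix s a' l.2) a = a' := by
          funext i
          have := key i
          simp only [mix]
          split_ifs at this ⊢
          · rfl
          · exact this
        refine ⟨(⟨s, by omega⟩, mix s a' l.2), ?_⟩
        refine Prod.ext ?_ ?_
        · simp only [G, ha', h₁]
        · simp only [G, ha']
          funext i
          have := key i
          simp only [mix]
          split_ifs at this ⊢
          · exact this.symm
          · rfl
    _ ≤ Fintype.card (Fin (m + 1) × BStr m) := Finset.card_image_le
    _ = (m + 1) * 2 ^ m := by simp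

/-! ### Gray codes and the encoding of network vertices -/

theorem hammingDist_cons {k : ℕ} (a b : Bool) (f g : Fin k → Bool) :
    hammingDist (Fin.cons a f : Fin (k + 1) → Bool) (Fin.cons b g) =
      (if a ≠ b then 1 else 0) + hammingDist f g := by
  simp only [hammingDist, Finset.card_filter, Fin.sum_univ_succ, Fin.cons_zero, Fin.cons_succ]

/-- The reflected Gray code, constant from `2 ^ k - 1` on. -/
def grayCode : (k : ℕ) → ℕ → Fin k → Bool
  | 0, _ => Fin.elim0
  | k + 1, i =>
    if i < 2 ^ k then Fin.cons false (grayCode k i)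
    else Fin.cons true (grayCode k (2 ^ (k + 1) - 1 - i))

theorem hammingDist_grayCode_succ (k i : ℕ) :
    hammingDist (grayCode k i) (grayCode k (i + 1)) ≤ 1 := by
  induction k generalizing i with
  | zero => simp [hammingDist]
  | succ k ih =>
    simp only [grayCode]
    have h2 : 2 ^ (k + 1) = 2 * 2 ^ k := by ring
    split_ifs with h₁ h₂ h₂
    · simpa [hammingDist_cons] using ih i
    · have : 2 ^ (k + 1) - 1 - (i + 1) = i := by omega
      simp [hammingDist_cons, this]
    · omega
    · rw [hammingDist_cons]
      by_cases h₃ : i + 1 < 2 ^ (k + 1)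
      · have : 2 ^ (k + 1) - 1 - i = 2 ^ (k + 1) - 1 - (i + 1) + 1 := by omega
        rw [this, hammingDist_comm]
        simpa using ih _
      · have : 2 ^ (k + 1) - 1 - i = 2 ^ (k + 1) - 1 - (i + 1) := by omega
        simp [this]

theorem grayCode_injOn (k : ℕ) : Set.InjOn (grayCode k) {i | i < 2 ^ k} := by
  induction k with
  | zero =>
    intro i hi j hj _
    simp only [pow_zero, Set.mem_ofPred_eq] at hi hj
    omega
  | succ k ih =>
    intro i hi j hj hij
    simp only [Set.mem_ofPred_eq] at hi hj
    have h2 : 2 ^ (k + 1) = 2 * 2 ^ k := by ring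
    simp only [grayCode] at hij
    split_ifs at hij with h₁ h₂ h₂
    · exact ih h₁ h₂ (Fin.cons_right_injective _ hij)
    · simpa using congrFun hij 0
    · simpa using congrFun hij 0
    · have := ih (x₁ := 2 ^ (k + 1) - 1 - i) (x₂ := 2 ^ (k + 1) - 1 - j)
        (by simp only [Set.mem_ofPred_eq]; omega) (by simp only [Set.mem_ofPred_eq]; omega)
        (Fin.cons_right_injective _ hij)
      omega

/-- The binary label of a network vertex, given a partition of the `n` coordinates. -/
def encode {n κ m : ℕ} (e : Fin n ≃ Unit ⊕ Fin κ ⊕ Fin κ ⊕ Fin m) (v : NetVertex m) : BStr n :=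
  fun i => Sum.elim (fun _ => v.1) (Sum.elim (grayCode κ v.2.1)
    (Sum.elim (grayCode κ v.2.2.1) v.2.2.2)) (e i)

theorem hammingDist_encode {n κ m : ℕ} (e : Fin n ≃ Unit ⊕ Fin κ ⊕ Fin κ ⊕ Fin m)
    (u v : NetVertex m) :
    hammingDist (encode e u) (encode e v) =
      (if u.1 ≠ v.1 then 1 else 0) + (hammingDist (grayCode κ u.2.1) (grayCode κ v.2.1) +
        (hammingDist (grayCode κ u.2.2.1) (grayCode κ v.2.2.1) +
          hammingDist u.2.2.2 v.2.2.2)) := by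
  simp only [hammingDist, Finset.card_filter]
  refine (Equiv.sum_comp e (fun j => if Sum.elim (fun _ => u.1) (Sum.elim (grayCode κ u.2.1)
    (Sum.elim (grayCode κ u.2.2.1) u.2.2.2)) j ≠ Sum.elim (fun _ => v.1)
    (Sum.elim (grayCode κ v.2.1) (Sum.elim (grayCode κ v.2.2.1) v.2.2.2)) j then 1 else 0)).trans ?_
  simp only [Fintype.sum_sum_type, Sum.elim_inl, Sum.elim_inr, Finset.univ_unique,
    Finset.sum_singleton]
  congr!

theorem encode_injOn {n κ m : ℕ} (e : Fin n ≃ Unit ⊕ Fin κ ⊕ Fin κ ⊕ Fin m) :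
    Set.InjOn (encode e) {v | v.2.1 < 2 ^ κ ∧ v.2.2.1 < 2 ^ κ} := by
  rintro ⟨l, k, s, w⟩ ⟨hk, hs⟩ ⟨l', k', s', w'⟩ ⟨hk', hs'⟩ h
  have h' := hammingDist_encode e (l, k, s, w) (l', k', s', w')
  rw [h, hammingDist_self] at h'
  have h1 : l = l' := by
    by_contra hne
    simp only [ne_eq, hne, not_false_eq_true, if_true] at h'
    omega
  have h2 : hammingDist (grayCode κ k) (grayCode κ k') = 0 := by dsimp only at h'; omega
  have h3 : hammingDist (grayCode κ s) (grayCode κ s') = 0 := by dsimp only at h'; omega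
  have h4 : hammingDist w w' = 0 := by dsimp only at h'; omega
  rw [hammingDist_eq_zero] at h2 h3 h4
  obtain rfl : k = k' := grayCode_injOn κ hk hk' h2
  obtain rfl : s = s' := grayCode_injOn κ hs hs' h3
  rw [h1, h4]

theorem hammingDist_grayCode_pred (k i : ℕ) :
    hammingDist (grayCode k i) (grayCode k (i - 1)) ≤ 1 := by
  rcases i with _ | i
  · simp
  · rw [hammingDist_comm]
    exact hammingDist_grayCode_succ k i

theorem hammingDist_setBit {m : ℕ} (s : ℕ) (b : Bool) (w : BStr m) :
    hammingDist w (setBit s b w) ≤ 1 := by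
  unfold hammingDist setBit
  rw [Finset.card_le_one]
  intro i hi j hj
  simp only [Finset.mem_filter, Finset.mem_univ, true_and] at hi hj
  have h₁ : i.val = s := by
    by_contra h
    simp [h] at hi
  have h₂ : j.val = s := by
    by_contra h
    simp [h] at hj
  exact Fin.ext (h₁.trans h₂.symm)

theorem hammingDist_encode_le {n κ m : ℕ} (e : Fin n ≃ Unit ⊕ Fin κ ⊕ Fin κ ⊕ Fin m)
    {u v : NetVertex m} (h : v ∈ neighbours u) : hammingDist (encode e u) (encode e v) ≤ 4 := by
  rw [hammingDist_encode]
  have hl : (if u.1 ≠ v.1 then 1 else 0) ≤ 1 := by split_ifs <;> simp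
  have h1 := hammingDist_grayCode_succ κ u.2.1
  have h2 := hammingDist_grayCode_succ κ u.2.2.1
  have h3 := hammingDist_grayCode_pred κ u.2.1
  have h4 := hammingDist_grayCode_pred κ u.2.2.1
  have h5 : ∀ s b, hammingDist u.2.2.2 (setBit s b u.2.2.2) ≤ 1 :=
    fun s b => hammingDist_setBit s b _
  have h6 := h5 u.2.2.1
  have h7 := h5 (u.2.2.1 - 1)
  have := h6 true
  have := h6 false
  have := h7 true
  have := h7 false
  simp only [neighbours, Finset.mem_insert, Finset.mem_singleton] at h
  rcases h with rfl | rfl | rfl | rfl | rfl | rfl | rfl <;>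
    simp only [hammingDist_self] at * <;> omega

/-! ### Averaging over labelled permutations -/

section Counting

variable {A L : Type*} (conf : A → A → L → A → A → L → Prop)

/-- No two distinct indices outside `D` are in conflict. -/
def ConflictFree (π : Equiv.Perm A) (lab : A → L) (D : A → Prop) : Prop :=
  ∀ a a', ¬ D a → ¬ D a' → a ≠ a' → ¬ conf a (π a) (lab a) a' (π a') (lab a')

variable [DecidableEq A]

theorem mul_swap_apply_iff (π : Equiv.Perm A) (z a b : A) :
    ((π * Equiv.swap a (π.symm z)) b = z ∨ b = π.symm z) ↔ (π b = z ∨ b = a) := by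
  rw [Equiv.Perm.mul_apply, ← Equiv.eq_symm_apply π, ← Equiv.eq_symm_apply π,
    ← Equiv.eq_symm_apply (Equiv.swap a (π.symm z)), or_comm]
  simp

theorem mul_swap_apply_of_not {π : Equiv.Perm A} {z a b : A} (hb : ¬ (π b = z ∨ b = a)) :
    (π * Equiv.swap a (π.symm z)) b = π b := by
  push Not at hb
  rw [Equiv.Perm.mul_apply, Equiv.swap_apply_of_ne_of_ne hb.2]
  rintro rfl
  simp at hb

theorem symm_mul_swap_apply (π : Equiv.Perm A) (z a : A) :
    (π * Equiv.swap a (π.symm z)).symm z = a := by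
  rw [Equiv.symm_apply_eq]
  simp

theorem conflictFree_mul_swap {conf : A → A → L → A → A → L → Prop} {z : A} {π : Equiv.Perm A} {lab : A → L} {a : A}
    (h : ConflictFree conf π lab fun b => π b = z ∨ b = a) :
    ConflictFree conf (π * Equiv.swap a (π.symm z)) lab
      fun b => (π * Equiv.swap a (π.symm z)) b = z ∨ b = π.symm z := by
  intro b b' hb hb' hbb'
  simp only [mul_swap_apply_iff] at hb hb'
  rw [mul_swap_apply_of_not hb, mul_swap_apply_of_not hb']
  exact h b b' hb hb' hbb'

variable [Fintype A] [Fintype L]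

open Classical in
theorem card_le_two_mul_card_of_swap {z : A} (conf : A → A → L → A → A → L → Prop)
    (sens : Equiv.Perm A → (A → L) → A → Prop)
    (hsens : ∀ π lab a, π a ≠ z → ConflictFree conf π lab (fun b => π b = z ∨ b = a) →
      sens π lab a ∨ sens (π * Equiv.swap a (π.symm z)) lab (π.symm z)) :
    (Finset.univ.filter fun p : (Equiv.Perm A × (A → L)) × A =>
      p.1.1 p.2 ≠ z ∧ ConflictFree conf p.1.1 p.1.2 fun b => p.1.1 b = z ∨ b = p.2).card ≤
    2 * (Finset.univ.filter fun p : (Equiv.Perm A × (A → L)) × A =>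
      (p.1.1 p.2 ≠ z ∧ ConflictFree conf p.1.1 p.1.2 fun b => p.1.1 b = z ∨ b = p.2) ∧
        sens p.1.1 p.1.2 p.2).card := by
  let good : (Equiv.Perm A × (A → L)) × A → Prop := fun p =>
    p.1.1 p.2 ≠ z ∧ ConflictFree conf p.1.1 p.1.2 fun b => p.1.1 b = z ∨ b = p.2
  let τ : (Equiv.Perm A × (A → L)) × A → (Equiv.Perm A × (A → L)) × A := fun p =>
    ((p.1.1 * Equiv.swap p.2 (p.1.1.symm z), p.1.2), p.1.1.symm z)
  have hττ : ∀ p, τ (τ p) = p := by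
    rintro ⟨⟨π, lab⟩, a⟩
    simp only [τ, symm_mul_swap_apply]
    rw [Equiv.swap_comm (π.symm z) a, mul_assoc, Equiv.swap_mul_self, mul_one]
  have hle : ((Finset.univ.filter good).filter fun p => ¬ sens p.1.1 p.1.2 p.2).card ≤
      ((Finset.univ.filter good).filter fun p => sens p.1.1 p.1.2 p.2).card := by
    refine Finset.card_le_card_of_injOn τ ?_ fun p _ p' _ h => by rw [← hττ p, h, hττ]
    rintro ⟨⟨π, lab⟩, a⟩ hp
    simp only [Finset.coe_filter, Finset.mem_filter, Finset.mem_univ, true_and,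
      Set.mem_ofPred_eq, good] at hp ⊢
    obtain ⟨⟨ha, hv⟩, hs⟩ := hp
    exact ⟨⟨by simpa [τ] using ha, conflictFree_mul_swap hv⟩, (hsens π lab a ha hv).resolve_left hs⟩
  have hadd := Finset.card_filter_add_card_filter_not (s := Finset.univ.filter good)
    (fun p => sens p.1.1 p.1.2 p.2)
  rw [Finset.filter_filter (s := Finset.univ) (p := good)
    (q := fun p => sens p.1.1 p.1.2 p.2)] at hadd hle
  simp only [good] at hadd hle
  omega

open Classical in
theorem four_mul_card_not_conflictFree_le {z : A} {conf : A → A → L → A → A → L → Prop}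
    (hsymm : ∀ a b l a' b' l', conf a b l a' b' l' → conf a' b' l' a b l)
    (hcount : ∀ (π : Equiv.Perm A) (lab : A → L) (a : A),
      4 * (Finset.univ.filter fun l => ∃ a' ≠ a, conf a (π a) l a' (π a') (lab a')).card ≤
        Fintype.card L) [Nonempty L] :
    4 * (Finset.univ.filter fun p : (Equiv.Perm A × (A → L)) × A =>
      (p.1.1 p.2 ≠ z ∧ ConflictFree conf p.1.1 p.1.2 fun b => p.1.1 b = z ∨ b = p.2) ∧
        ¬ ConflictFree conf p.1.1 p.1.2 fun b => p.1.1 b = z).card ≤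
    (Finset.univ.filter fun p : (Equiv.Perm A × (A → L)) × A =>
      p.1.1 p.2 ≠ z ∧ ConflictFree conf p.1.1 p.1.2 fun b => p.1.1 b = z ∨ b = p.2).card := by
  set P := Finset.univ.filter fun p : (Equiv.Perm A × (A → L)) × A =>
    p.1.1 p.2 ≠ z ∧ ConflictFree conf p.1.1 p.1.2 fun b => p.1.1 b = z ∨ b = p.2 with hP
  set R := Finset.univ.filter fun p : (Equiv.Perm A × (A → L)) × A =>
    (p.1.1 p.2 ≠ z ∧ ConflictFree conf p.1.1 p.1.2 fun b => p.1.1 b = z ∨ b = p.2) ∧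
      ¬ ConflictFree conf p.1.1 p.1.2 fun b => p.1.1 b = z with hR
  let bad : (Equiv.Perm A × (A → L)) × A → L → Prop := fun p l =>
    ∃ a' ≠ p.2, conf p.2 (p.1.1 p.2) l a' (p.1.1 a') (p.1.2 a')
  let σ : ((Equiv.Perm A × (A → L)) × A) × L → ((Equiv.Perm A × (A → L)) × A) × L := fun x =>
    (((x.1.1.1, Function.update x.1.1.2 x.1.2 x.2), x.1.2), x.1.1.2 x.1.2)
  have hσσ : ∀ x, σ (σ x) = x := by
    rintro ⟨⟨⟨π, lab⟩, a⟩, l⟩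
    simp [σ]
  have hle : (R ×ˢ (Finset.univ : Finset L)).card ≤
      ((P ×ˢ Finset.univ).filter fun x => bad x.1 x.2).card := by
    refine Finset.card_le_card_of_injOn σ ?_ fun p _ p' _ h => by rw [← hσσ p, h, hσσ]
    rintro ⟨⟨⟨π, lab⟩, a⟩, l⟩ hx
    simp only [hR, hP, Finset.coe_filter, Finset.coe_product, Finset.coe_univ, Set.mem_prod,
      Set.mem_univ, Finset.mem_product, Finset.mem_filter, Finset.mem_univ, true_and, and_true,
      Set.mem_ofPred_eq, σ, bad] at hx ⊢
    obtain ⟨⟨ha, hv⟩, hn⟩ := hx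
    refine ⟨⟨ha, ?_⟩, ?_⟩
    · intro b b' hb hb'
      rw [Function.update_of_ne fun h => hb (Or.inr h),
        Function.update_of_ne fun h => hb' (Or.inr h)]
      exact hv b b' hb hb'
    · have : ∃ a' ≠ a, conf a (π a) (lab a) a' (π a') (lab a') := by
        unfold ConflictFree at hn
        push Not at hn
        obtain ⟨b, b', hb, hb', hbb', hc⟩ := hn
        by_cases h₁ : b = a
        · subst h₁
          exact ⟨b', hbb'.symm, hc⟩
        · by_cases h₂ : b' = a
          · subst h₂
            exact ⟨b, hbb', hsymm _ _ _ _ _ _ hc⟩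
          · exact absurd hc (hv b b' (by tauto) (by tauto) hbb')
      obtain ⟨a', ha', hc⟩ := this
      refine ⟨a', ha', ?_⟩
      rwa [Function.update_of_ne ha']
  rw [Finset.card_product, Finset.card_univ, Finset.card_filter _ (P ×ˢ Finset.univ),
    Finset.sum_product] at hle
  have hsum : 4 * ∑ p ∈ P, ∑ l : L, (if bad p l then 1 else 0) ≤ P.card * Fintype.card L := by
    rw [Finset.mul_sum, ← smul_eq_mul (P.card), ← Finset.sum_const]
    refine Finset.sum_le_sum fun p _ => ?_
    rw [← Finset.card_filter]
    exact hcount p.1.1 p.1.2 p.2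
  have hL : 0 < Fintype.card L := Fintype.card_pos
  refine Nat.le_of_mul_le_mul_right (c := Fintype.card L) ?_ hL
  calc _ = 4 * (R.card * Fintype.card L) := by ring
    _ ≤ _ := (Nat.mul_le_mul_left 4 hle).trans hsum

open Classical in
theorem exists_conflictFree_many_sensitive {z : A} {conf : A → A → L → A → A → L → Prop}
    (hsymm : ∀ a b l a' b' l', conf a b l a' b' l' → conf a' b' l' a b l)
    (hcount : ∀ (π : Equiv.Perm A) (lab : A → L) (a : A),
      4 * (Finset.univ.filter fun l => ∃ a' ≠ a, conf a (π a) l a' (π a') (lab a')).card ≤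
        Fintype.card L)
    (hne : ∃ π lab, ConflictFree conf π lab fun b => π b = z)
    (sens : Equiv.Perm A → (A → L) → A → Prop)
    (hsens : ∀ π lab a, π a ≠ z → ConflictFree conf π lab (fun b => π b = z ∨ b = a) →
      sens π lab a ∨ sens (π * Equiv.swap a (π.symm z)) lab (π.symm z)) :
    ∃ π lab, ConflictFree conf π lab (fun b => π b = z) ∧
      Fintype.card A - 1 ≤ 4 * (Finset.univ.filter fun a => π a ≠ z ∧ sens π lab a).card := by
  obtain ⟨π₀, lab₀, h₀⟩ := hne
  have : Nonempty L := ⟨lab₀ z⟩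
  have h₁ := card_le_two_mul_card_of_swap conf sens hsens
  have h₂ := four_mul_card_not_conflictFree_le (z := z) hsymm hcount
  set P := Finset.univ.filter fun p : (Equiv.Perm A × (A → L)) × A =>
    p.1.1 p.2 ≠ z ∧ ConflictFree conf p.1.1 p.1.2 fun b => p.1.1 b = z ∨ b = p.2
  set R := Finset.univ.filter fun p : (Equiv.Perm A × (A → L)) × A =>
    (p.1.1 p.2 ≠ z ∧ ConflictFree conf p.1.1 p.1.2 fun b => p.1.1 b = z ∨ b = p.2) ∧
      ¬ ConflictFree conf p.1.1 p.1.2 fun b => p.1.1 b = z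
  set S := Finset.univ.filter fun p : (Equiv.Perm A × (A → L)) × A =>
    (p.1.1 p.2 ≠ z ∧ ConflictFree conf p.1.1 p.1.2 fun b => p.1.1 b = z ∨ b = p.2) ∧
      sens p.1.1 p.1.2 p.2
  let X := Finset.univ.filter fun x : Equiv.Perm A × (A → L) =>
    ConflictFree conf x.1 x.2 fun b => x.1 b = z
  let Q := (X ×ˢ (Finset.univ : Finset A)).filter fun p => p.1.1 p.2 ≠ z
  let QS := (X ×ˢ (Finset.univ : Finset A)).filter fun p => p.1.1 p.2 ≠ z ∧ sens p.1.1 p.1.2 p.2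
  have hSle : S.card ≤ R.card + QS.card := by
    refine (Finset.card_le_card ?_).trans (Finset.card_union_le R QS)
    intro p hp
    simp only [S, R, QS, X, Finset.mem_filter, Finset.mem_union, Finset.mem_product,
      Finset.mem_univ, true_and, and_true] at hp ⊢
    tauto
  have hQP : Q.card ≤ P.card := by
    refine Finset.card_le_card fun p hp => ?_
    simp only [P, Q, X, Finset.mem_filter, Finset.mem_product, Finset.mem_univ, true_and,
      and_true] at hp ⊢
    exact ⟨hp.2, fun b b' hb hb' => hp.1 b b' (fun h => hb (Or.inl h)) fun h => hb' (Or.inl h)⟩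
  have hQ : Q.card = X.card * (Fintype.card A - 1) := by
    simp only [Q]
    rw [Finset.card_filter, Finset.sum_product, ← smul_eq_mul, ← Finset.sum_const]
    refine Finset.sum_congr rfl fun x _ => ?_
    rw [← Finset.card_filter, ← Finset.card_univ, ← Finset.card_erase_of_mem
      (Finset.mem_univ (x.1.symm z))]
    congr 1
    ext a
    simp [Equiv.eq_symm_apply]
  have hQS : QS.card = ∑ x ∈ X, (Finset.univ.filter fun a => x.1 a ≠ z ∧ sens x.1 x.2 a).card := by
    simp only [QS, Finset.card_filter, Finset.sum_product]
  by_contra! hcon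
  have hlt : 4 * QS.card < X.card * (Fintype.card A - 1) := by
    rw [hQS, Finset.mul_sum, ← smul_eq_mul (X.card), ← Finset.sum_const]
    refine Finset.sum_lt_sum_of_nonempty ⟨(π₀, lab₀), by simpa [X] using h₀⟩ fun x hx => ?_
    exact hcon x.1 x.2 (by simpa [X] using hx)
  omega

end Counting

/-! ### The host graph -/

/-- A left inverse of `encode e` on the network vertices of the host graph. -/
noncomputable def decode {n κ m : ℕ} (e : Fin n ≃ Unit ⊕ Fin κ ⊕ Fin κ ⊕ Fin m) :
    BStr n → NetVertex m :=
  Function.invFunOn (encode e) {v | v.2.1 < 2 ^ κ ∧ v.2.2.1 < 2 ^ κ}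

theorem decode_encode {n κ m : ℕ} (e : Fin n ≃ Unit ⊕ Fin κ ⊕ Fin κ ⊕ Fin m) {v : NetVertex m}
    (hv : v.2.1 < 2 ^ κ ∧ v.2.2.1 < 2 ^ κ) : decode e (encode e v) = v :=
  (encode_injOn e).leftInvOn_invFunOn hv

/-- The edges of the host graph. -/
noncomputable def hostEdges {n κ m : ℕ} (e : Fin n ≃ Unit ⊕ Fin κ ⊕ Fin κ ⊕ Fin m) :
    Finset (BStr n × BStr n) :=
  Finset.univ.filter fun p => p.2 ∈ (neighbours (decode e p.1)).image (encode e) ∧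
    p.1 ∈ (neighbours (decode e p.2)).image (encode e) ∧ hammingDist p.1 p.2 ≤ 4

section Host

variable {n κ m : ℕ} (e : Fin n ≃ Unit ⊕ Fin κ ⊕ Fin κ ⊕ Fin m)

theorem card_hostEdges_snd_le (v : BStr n) :
    ((hostEdges e).filter fun p => p.2 = v).card ≤ 7 := by
  refine le_trans ?_ ((Finset.card_image_le (f := encode e)).trans
    (card_neighbours_le (decode e v)))
  refine Finset.card_le_card_of_injOn Prod.fst ?_ ?_
  · rintro ⟨x, y⟩ h
    simp only [hostEdges, Finset.coe_filter, Finset.mem_filter, Finset.mem_univ, true_and,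
      Set.mem_ofPred_eq] at h
    obtain ⟨h, rfl⟩ := h
    exact h.2.1
  · rintro ⟨x, y⟩ h ⟨x', y'⟩ h' he
    simp only [Finset.coe_filter, Set.mem_ofPred_eq] at h h'
    exact Prod.ext he (h.2.trans h'.2.symm)

theorem card_hostEdges_fst_le (v : BStr n) :
    ((hostEdges e).filter fun p => p.1 = v).card ≤ 7 := by
  refine le_trans ?_ ((Finset.card_image_le (f := encode e)).trans
    (card_neighbours_le (decode e v)))
  refine Finset.card_le_card_of_injOn Prod.snd ?_ ?_
  · rintro ⟨x, y⟩ h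
    simp only [hostEdges, Finset.coe_filter, Finset.mem_filter, Finset.mem_univ, true_and,
      Set.mem_ofPred_eq] at h
    obtain ⟨h, rfl⟩ := h
    exact h.1
  · rintro ⟨x, y⟩ h ⟨x', y'⟩ h' he
    simp only [Finset.coe_filter, Set.mem_ofPred_eq] at h h'
    exact Prod.ext (h.2.trans h'.2.symm) he

theorem mem_hostEdges {u v : NetVertex m} (hu : u.2.1 < 2 ^ κ ∧ u.2.2.1 < 2 ^ κ)
    (hv : v.2.1 < 2 ^ κ ∧ v.2.2.1 < 2 ^ κ) (h : v ∈ neighbours u ∧ u ∈ neighbours v) :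
    (encode e u, encode e v) ∈ hostEdges e := by
  simp only [hostEdges, Finset.mem_filter, Finset.mem_univ, true_and, decode_encode e hu,
    decode_encode e hv]
  exact ⟨Finset.mem_image_of_mem _ h.1, Finset.mem_image_of_mem _ h.2,
    hammingDist_encode_le e h.1⟩

/-- The terminals at which the routes start. -/
def source (a : BStr m) : BStr n := encode e (false, 0, 0, a)

/-- The terminals at which the routes end. -/
def sink (b : BStr m) : BStr n := encode e (true, 0, 0, b)

/-- The path in the host graph from `source e a` to `sink e (π a)` with label `lab a`. -/
def hostPath (π : Equiv.Perm (BStr m)) (lab : BStr m → Fin (2 ^ κ) × BStr m) (a : BStr m) (i : ℕ) :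
    BStr n :=
  encode e (route a (π a) (lab a) i)

/-- Two routes are in conflict if they meet in a butterfly on one of the two sides. -/
def RouteConflict {m K : ℕ} (a b : BStr m) (l : Fin K × BStr m) (a' b' : BStr m)
    (l' : Fin K × BStr m) : Prop :=
  HalfConflict a l a' l' ∨ HalfConflict b l b' l'

theorem isPathSystem_hostPath (hm : m < 2 ^ κ) {z : BStr m} {π : Equiv.Perm (BStr m)}
    {lab : BStr m → Fin (2 ^ κ) × BStr m}
    (h : ConflictFree RouteConflict π lab fun a => π a = z) :
    IsPathSystem (source e) (sink e) z π (hostPath e π lab) fun a => routeLength (lab a) := by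
  have hvalid : ∀ a i, route a (π a) (lab a) i ∈
      {v : NetVertex m | v.2.1 < 2 ^ κ ∧ v.2.2.1 < 2 ^ κ} := fun a i =>
    ⟨(route_valid _ _ _ i).1, (route_valid _ _ _ i).2.trans_lt hm⟩
  refine ⟨fun a => by simp [hostPath, source, route_zero],
    fun a => by simp [hostPath, sink, route_length], ?_, ?_⟩
  · intro a a' i i' ha ha' hi hi' he
    have hr := route_inj hi hi' (encode_injOn e (hvalid a i) (hvalid a' i') he)
    by_cases haa : a = a'
    · subst haa
      exact ⟨rfl, hr.2 rfl⟩
    · exact absurd (hr.1 haa (π.injective.ne haa)) (h a a' ha ha' haa)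
  · intro a i t ht ha _ he
    refine route_ne_start (lab a) i ?_ (encode_injOn e (hvalid a i) ?_ he)
    · rintro rfl
      exact ha ht
    · simp

theorem mem_hostEdges_of_pathEdges (hm : m < 2 ^ κ) {z : BStr m} {π : Equiv.Perm (BStr m)}
    {lab : BStr m → Fin (2 ^ κ) × BStr m} {D : BStr m → Prop} {u v : BStr n}
    (h : PathEdges (source e) (sink e) z (hostPath e π lab) (fun a => routeLength (lab a)) D u v) :
    (u, v) ∈ hostEdges e := by
  rcases h with ⟨a, i, -, hi, rfl, rfl⟩ | ⟨b, -, rfl, rfl⟩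
  · exact mem_hostEdges e ⟨(route_valid _ _ _ _).1, (route_valid _ _ _ _).2.trans_lt hm⟩
      ⟨(route_valid _ _ _ _).1, (route_valid _ _ _ _).2.trans_lt hm⟩ (mem_neighbours_route _ _ _ hi)
  · exact mem_hostEdges e (by simp) (by simp) (mem_neighbours_not true _)

end Host

open Classical in
theorem four_mul_card_routeConflict_le {m K : ℕ} (hK : 8 * (m + 1) ≤ K)
    (π : Equiv.Perm (BStr m)) (lab : BStr m → Fin K × BStr m) (a : BStr m) :
    4 * (Finset.univ.filter fun l =>
      ∃ a' ≠ a, RouteConflict a (π a) l a' (π a') (lab a')).card ≤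
        Fintype.card (Fin K × BStr m) := by
  have h : (Finset.univ.filter fun l =>
      ∃ a' ≠ a, RouteConflict a (π a) l a' (π a') (lab a')).card ≤
      (m + 1) * 2 ^ m + (m + 1) * 2 ^ m := by
    refine ((Finset.card_le_card ?_).trans (Finset.card_union_le _ _)).trans
      (add_le_add (card_halfConflict_le a lab)
        (card_halfConflict_le (π a) fun b => lab (π.symm b)))
    intro l hl
    simp only [Finset.mem_filter, Finset.mem_univ, true_and, Finset.mem_union] at hl ⊢
    obtain ⟨a', -, hc | hc⟩ := hl
    · exact Or.inl ⟨a', hc⟩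
    · exact Or.inr ⟨π a', by simpa using hc⟩
  have hcard : Fintype.card (Fin K × BStr m) = K * 2 ^ m := by simp
  rw [hcard]
  calc _ ≤ 4 * ((m + 1) * 2 ^ m + (m + 1) * 2 ^ m) := Nat.mul_le_mul_left 4 h
    _ = 8 * (m + 1) * 2 ^ m := by ring
    _ ≤ _ := Nat.mul_le_mul_right _ hK

theorem exists_conflictFree {m K : ℕ} (hK : 0 < K) (z : BStr m) :
    ∃ (π : Equiv.Perm (BStr m)) (lab : BStr m → Fin K × BStr m),
      ConflictFree RouteConflict π lab fun a => π a = z := by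
  refine ⟨1, fun a => (⟨0, hK⟩, a), fun a a' _ _ haa' h => haa' ?_⟩
  have hmix : ∀ (s : ℕ) (a : BStr m), mix s a a = a := fun s a => by
    funext i
    simp [mix]
  simp only [RouteConflict, HalfConflict, hmix, true_and, Equiv.Perm.one_apply, or_self] at h
  exact h.choose_spec.2

theorem pathEdges_mul_swap {n κ m : ℕ} (e : Fin n ≃ Unit ⊕ Fin κ ⊕ Fin κ ⊕ Fin m) (z a : BStr m)
    (π : Equiv.Perm (BStr m)) (lab : BStr m → Fin (2 ^ κ) × BStr m) :
    PathEdges (source e) (sink e) z (hostPath e (π * Equiv.swap a (π.symm z)) lab)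
      (fun b => routeLength (lab b))
      (fun b => (π * Equiv.swap a (π.symm z)) b = z ∨ b = π.symm z) =
    PathEdges (source e) (sink e) z (hostPath e π lab) (fun b => routeLength (lab b))
      (fun b => π b = z ∨ b = a) := by
  funext u v
  refine propext (or_congr_left (exists_congr fun b => exists_congr fun i => ?_))
  simp only [mul_swap_apply_iff]
  refine and_congr_right fun hb => ?_
  simp only [hostPath, mul_swap_apply_of_not hb]

open Classical in
theorem exists_critical_many_blocks {n κ m : ℕ} (e : Fin n ≃ Unit ⊕ Fin κ ⊕ Fin κ ⊕ Fin m)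
    (hκ : 8 * (m + 1) ≤ 2 ^ κ) (z : BStr m) (f : ({p // p ∈ hostEdges e} → Bool) → BStr n)
    (hf : ∀ x, QSolution (hostEdges e) (source e z) x (f x)) :
    ∃ x, QCritical (hostEdges e) (source e z) x ∧
      ∃ (b : ℕ) (B : Fin b → Finset {p // p ∈ hostEdges e}), 2 ^ m - 1 ≤ 4 * b ∧
        (∀ i j, i ≠ j → Disjoint (B i) (B j)) ∧
        ∀ i, f (flipBits (hostEdges e) x (B i)) ≠ f x := by
  have hm : m < 2 ^ κ := by omega
  let input : Equiv.Perm (BStr m) → (BStr m → Fin (2 ^ κ) × BStr m) → (BStr m → Prop) →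
      {p // p ∈ hostEdges e} → Bool := fun π lab D =>
    relInput (hostEdges e)
      (PathEdges (source e) (sink e) z (hostPath e π lab) (fun a => routeLength (lab a)) D)
  have hsource : Function.Injective (source (m := m) e) := by
    intro a b hab
    have := encode_injOn e (by simp) (by simp) hab
    simpa using this
  obtain ⟨π, lab, hfree, hcard⟩ := exists_conflictFree_many_sensitive (z := z)
    (conf := RouteConflict (m := m) (K := 2 ^ κ))
    (fun _ _ _ _ _ _ h => h.imp HalfConflict.symm HalfConflict.symm)
    (four_mul_card_routeConflict_le hκ) (exists_conflictFree (by positivity) z)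
    (fun π lab a => f (input π lab fun b => π b = z ∨ b = a) ≠ source e (π.symm z)) (by
      intro π lab a ha _
      have hswap : input (π * Equiv.swap a (π.symm z)) lab
          (fun b => (π * Equiv.swap a (π.symm z)) b = z ∨ b = π.symm z) =
          input π lab fun b => π b = z ∨ b = a :=
        congrArg (relInput (hostEdges e)) (pathEdges_mul_swap e z a π lab)
      rw [hswap, symm_mul_swap_apply]
      by_contra! h
      have := hsource (h.1.symm.trans h.2)
      exact ha (by rw [← this]; simp))
  have hsys := isPathSystem_hostPath e hm hfree
  have hsol := hsys.qSolution_iff (EH := hostEdges e) (π.apply_symm_apply z)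
    fun u v h => mem_hostEdges_of_pathEdges e hm h
  set s := Finset.univ.filter fun a => π a ≠ z ∧
    f (input π lab fun b => π b = z ∨ b = a) ≠ source e (π.symm z) with hs
  have hmem : ∀ i : Fin s.card, π (s.equivFin.symm i) ≠ z ∧
      f (input π lab fun b => π b = z ∨ b = s.equivFin.symm i) ≠ source e (π.symm z) := fun i =>
    (Finset.mem_filter.1 (s.equivFin.symm i).2).2
  refine ⟨input π lab fun a => π a = z, ⟨source e (π.symm z), (hsol _).2 rfl,
    fun v hv => (hsol v).1 hv⟩, s.card, fun i => pathBlock (hostEdges e) (hostPath e π lab)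
      (fun a => routeLength (lab a)) (s.equivFin.symm i), ?_, ?_, ?_⟩
  · simpa using hcard
  · intro i j hij
    refine hsys.disjoint_pathBlock (hmem i).1 (hmem j).1 fun h => hij ?_
    exact s.equivFin.symm.injective (Subtype.ext h)
  · intro i
    rw [(hsol _).1 (hf (input π lab fun a => π a = z))]
    have := hsys.flipBits_pathBlock (EH := hostEdges e) (hmem i).1
    simp only [input] at hmem ⊢
    rw [this]
    exact (hmem i).2

theorem exists_parameters {n : ℕ} (hn : 32 ≤ n) :
    ∃ κ m : ℕ, 1 + κ + κ + m = n ∧ 1 ≤ m ∧ 8 * (m + 1) ≤ 2 ^ κ ∧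
      (2 : ℝ) ^ n ≤ 2048 * n ^ 2 * 2 ^ m := by
  set κ := Nat.log 2 (8 * n + 8) + 1 with hκ
  have h₁ : 8 * n + 8 < 2 ^ κ := Nat.lt_pow_succ_log_self (by norm_num) _
  have h₂ : 2 ^ κ ≤ 2 * (8 * n + 8) := by
    rw [hκ, pow_succ, mul_comm]
    exact Nat.mul_le_mul_left 2 (Nat.pow_log_le_self 2 (by omega))
  have h₃ : 2 * κ + 2 ≤ n := by
    by_contra! hlt
    have h4 : (2 ^ κ) ^ 2 ≤ (2 * (8 * n + 8)) ^ 2 := Nat.pow_le_pow_left h₂ 2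
    have h5 : 2 ^ n ≤ 2 * (2 ^ κ) ^ 2 := by
      rw [← pow_mul, ← pow_succ']
      exact Nat.pow_le_pow_right (by norm_num) (by omega)
    have h6 : ∀ k, 32 ≤ k → 2 * (2 * (8 * k + 8)) ^ 2 < 2 ^ k := by
      intro k hk
      induction k, hk using Nat.le_induction with
      | base => norm_num
      | succ k hk ih =>
        rw [pow_succ 2 k]
        nlinarith
    have := h6 n hn
    omega
  refine ⟨κ, n - (1 + κ + κ), by omega, by omega, by omega, ?_⟩
  have h7 : n = 1 + κ * 2 + (n - (1 + κ + κ)) := by omega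
  have h8 : (2 : ℝ) ^ κ ≤ 32 * n := by
    have : 2 ^ κ ≤ 32 * n := by omega
    exact_mod_cast this
  generalize n - (1 + κ + κ) = m at h7
  calc (2 : ℝ) ^ n = 2 * (2 ^ κ) ^ 2 * 2 ^ m := by
        conv_lhs => rw [h7]
        rw [pow_add, pow_add, pow_mul, pow_one]
    _ ≤ 2 * (32 * n) ^ 2 * 2 ^ m := by gcongr
    _ = _ := by ring

theorem stmt2 :
    ∃ (d Δ : ℕ) (c C : ℝ), 0 < c ∧ 0 < C ∧
      ∃ n₀ : ℕ, ∀ n : ℕ, n₀ ≤ n →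
        ∃ (EH : Finset (BStr n × BStr n)) (v₀ : BStr n),
          -- every vertex of `H` has in-degree at most `d` and out-degree at most `d`
          (∀ v : BStr n, (EH.filter (fun e => e.2 = v)).card ≤ d ∧
                         (EH.filter (fun e => e.1 = v)).card ≤ d) ∧
          -- labels of adjacent vertices differ in at most `Δ` coordinates
          (∀ e ∈ EH, hammingDist e.1 e.2 ≤ Δ) ∧
          -- critical block sensitivity lower bound
          (∀ f : ({e // e ∈ EH} → Bool) → BStr n,
            (∀ x, QSolution EH v₀ x (f x)) →
            ∃ x : {e // e ∈ EH} → Bool, QCritical EH v₀ x ∧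
              ∃ (b : ℕ) (B : Fin b → Finset {e // e ∈ EH}),
                c * 2 ^ n / (n : ℝ) ^ C ≤ (b : ℝ) ∧
                (∀ i j, i ≠ j → Disjoint (B i) (B j)) ∧
                (∀ i, f (flipBits EH x (B i)) ≠ f x)) := by
  refine ⟨7, 4, 1 / 16384, 2, by norm_num, by norm_num, 32, fun n hn => ?_⟩
  obtain ⟨κ, m, hsum, hm, hκ, hpow⟩ := exists_parameters hn
  have e : Fin n ≃ Unit ⊕ Fin κ ⊕ Fin κ ⊕ Fin m :=
    Fintype.equivOfCardEq (by simp; omega)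
  refine ⟨hostEdges e, source e fun _ => false,
    fun v => ⟨card_hostEdges_snd_le e v, card_hostEdges_fst_le e v⟩,
    fun p hp => (Finset.mem_filter.1 hp).2.2.2, fun f hf => ?_⟩
  obtain ⟨x, hx, b, B, hb, hdisj, hsens⟩ := exists_critical_many_blocks e hκ (fun _ => false) f hf
  refine ⟨x, hx, b, B, ?_, hdisj, hsens⟩
  have h2m : 2 ≤ 2 ^ m := Nat.pow_le_pow_right (n := 2) (by norm_num) hm
  have hb' : (2 : ℝ) ^ m ≤ 8 * b := by
    have : 2 ^ m ≤ 8 * b := by omega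
    exact_mod_cast this
  have hn0 : (0 : ℝ) < n := by
    have : 0 < n := by omega
    exact_mod_cast this
  rw [Real.rpow_two, div_le_iff₀ (by positivity)]
  have : (2048 : ℝ) * n ^ 2 * 2 ^ m ≤ 2048 * n ^ 2 * (8 * b) := by gcongr
  linarith
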